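/- For all integers m ≥ t ≥ 0, \sum_{i=0}^{t} \delta(m+t−i,i,0)·r(m+t−i,i,0) = (1/20)·( t(t+4) + m(m+4) )·r_m·r_t. (This identity expresses that the ch_2(Q)-coefficients of ch_2 match on both sides of the Pieri decomposition Sym^m Q ⊗ Sym^t Q = \bigoplus_{i=0}^{t} \Sigma_{(m+t−i,i,0,0)} Q.) -/

import Mathlib

/-- `r(m,t,s)`: the rank of `Σ_{(m,t,s,0)}` applied to a rank-4 bundle
(Weyl dimension formula). -/
def rP (m t s : ℚ) : ℚ :=
  (m + 3) * (t + 2) * (s + 1) * (m - t + 1) * (m - s + 2) * (t - s + 1) / 12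

/-- `ℓ(m,t,s) = (m+t+s)/4`. -/
def lP (m t s : ℚ) : ℚ := (m + t + s) / 4

/-- `τ(m,t,s) = (−2(mt+ms+ts)+3m+t−s)/3`. -/
def tauP (m t s : ℚ) : ℚ := (-2 * (m * t + m * s + t * s) + 3 * m + t - s) / 3

/-- `δ(m,t,s) = (4ℓ(m,t,s)^2 + τ(m,t,s))/5`. -/
def deltaP (m t s : ℚ) : ℚ := (4 * (lP m t s) ^ 2 + tauP m t s) / 5

/-- `α(t,s)`. -/
def alphaP (t s : ℚ) : ℚ := 9 * t ^ 2 + 21 * t * s + 9 * s ^ 2 - 33 * t - 30 * s + 21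

/-- `β(t,s)`. -/
def betaP (t s : ℚ) : ℚ :=
  21 * t ^ 2 * s + 21 * t * s ^ 2 - 15 * t ^ 2 - 18 * t * s + 6 * s ^ 2 + t - 8 * s - 6

/-- `γ(t,s)`. -/
def gammaP (t s : ℚ) : ℚ :=
  9 * t ^ 2 * s ^ 2 - 9 * t ^ 2 * s + 9 * t * s ^ 2 - 3 * t ^ 2 + 13 * t * s - 3 * s ^ 2 -
    14 * t + 14 * s

/-- `ξ(m,t,s) = (α(t,s)m^2 + β(t,s)m + γ(t,s))/60`. -/
def xiP (m t s : ℚ) : ℚ := (alphaP t s * m ^ 2 + betaP t s * m + gammaP t s) / 60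

/-- The identity with `m + t = x` fixed, by induction on `t = k`. -/
theorem pieri_aux (x : ℚ) (k : ℕ) :
    ∑ i ∈ Finset.range (k + 1), deltaP (x - (i : ℚ)) (i : ℚ) 0 * rP (x - (i : ℚ)) (i : ℚ) 0 =
      (1 / 20 : ℚ) * ((k : ℚ) * ((k : ℚ) + 4) + (x - k) * ((x - k) + 4)) *
        rP (x - k) 0 0 * rP (k : ℚ) 0 0 := by
  induction k with
  | zero => simp [deltaP, rP, lP, tauP]; ring
  | succ k ih =>
    rw [Finset.sum_range_succ, ih]
    simp only [deltaP, rP, lP, tauP]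
    push_cast
    ring

/-- Pieri identity for the `ch₂(Q)`-coefficient of `ch₂` in
`Sym^m Q ⊗ Sym^t Q = ⨁_{i=0}^t Σ_{(m+t−i,i,0,0)} Q`. -/
theorem ch2_ch2_pieri_sym (m t : ℤ) (ht : 0 ≤ t) (htm : t ≤ m) :
    ∑ i ∈ Finset.Icc (0 : ℤ) t,
        deltaP ((m : ℚ) + (t : ℚ) - (i : ℚ)) (i : ℚ) 0 *
          rP ((m : ℚ) + (t : ℚ) - (i : ℚ)) (i : ℚ) 0 =
      (1 / 20 : ℚ) * ((t : ℚ) * ((t : ℚ) + 4) + (m : ℚ) * ((m : ℚ) + 4)) *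
        rP (m : ℚ) 0 0 * rP (t : ℚ) 0 0 := by
  lift t to ℕ using ht
  have h := pieri_aux ((m : ℚ) + (t : ℚ)) t
  rw [add_sub_cancel_right] at h
  have e : Finset.Icc (0 : ℤ) (t : ℤ) = (Finset.range (t + 1)).map Nat.castEmbedding := by
    ext a
    simp only [Finset.mem_Icc, Finset.mem_map, Finset.mem_range, Nat.castEmbedding_apply]
    constructor
    · rintro ⟨h0, h1⟩
      exact ⟨a.toNat, by omega, by omega⟩
    · rintro ⟨b, hb, rfl⟩
      omega
  rw [e, Finset.sum_map]
  simpa using h
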